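/- arXiv:2506.03534 — 6 statements merged into one kernel-verified Lean document; each statement's English description precedes it below -/
import Mathlib

section
/- Let R be a commutative ring, let f₁,…,f_m ∈ R be a regular sequence, and let I = (f₁,…,f_m) be the ideal they generate. Let A = (n₁,…,n_m) be an m-tuple of nonnegative integers, write |A| = n₁+⋯+n_m and f^A = f₁^{n₁}⋯f_m^{n_m}. Then for every integer n ≥ |A|, the quotient ideal (Iⁿ : (f^A)) is equal to I^{n−|A|}. -/
namespace ColonPow

variable {R : Type*} [CommRing R]

lemma sup_pow_le (J : Ideal R) (g : R) (n : ℕ) :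
    (J ⊔ Ideal.span {g}) ^ (n + 1) ≤
      J ^ (n + 1) ⊔ Ideal.span {g} * (J ⊔ Ideal.span {g}) ^ n := by
  induction n with
  | zero => simp
  | succ n ih =>
    set I := J ⊔ Ideal.span {g} with hI
    have hJI : J ≤ I := le_sup_left
    calc I ^ (n + 1 + 1) = I ^ (n + 1) * J ⊔ I ^ (n + 1) * Ideal.span {g} := by
          rw [pow_succ I (n + 1), ← Ideal.mul_sup]
      _ ≤ _ := by
          refine sup_le ?_ ?_
          · refine (Ideal.mul_mono_left ih).trans ?_
            rw [Ideal.sup_mul, ← pow_succ, mul_assoc, pow_succ I n]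
            exact sup_le_sup le_rfl (Ideal.mul_mono_right (Ideal.mul_mono_right hJI))
          · rw [mul_comm]; exact le_sup_right

/-- Decomposition of elements of `K * I ^ (n+1)` where `I = J + (g)`. -/
lemma decomp (K J : Ideal R) (g : R) (n : ℕ) {x : R}
    (hx : x ∈ K * (J ⊔ Ideal.span {g}) ^ (n + 1)) :
    ∃ a ∈ K * J ^ (n + 1), ∃ b ∈ K * (J ⊔ Ideal.span {g}) ^ n, x = a + g * b := by
  have h := Ideal.mul_mono_right (I := K) (sup_pow_le J g n) hx
  rw [Ideal.mul_sup, mul_left_comm] at h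
  obtain ⟨a, ha, c, hc, rfl⟩ := Submodule.mem_sup.1 h
  obtain ⟨b, hb, rfl⟩ := Ideal.mem_span_singleton_mul.1 hc
  exact ⟨a, ha, b, hb, rfl⟩

lemma decomp' (J : Ideal R) (g : R) (n : ℕ) {x : R}
    (hx : x ∈ (J ⊔ Ideal.span {g}) ^ (n + 1)) :
    ∃ a ∈ J ^ (n + 1), ∃ b ∈ (J ⊔ Ideal.span {g}) ^ n, x = a + g * b := by
  have := decomp ⊤ J g n (x := x) (by simpa using hx)
  simpa using this

/-- `h` regular mod `K ≥ J` is regular on `J^n / K J^n`. -/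
def T (J : Ideal R) : Prop :=
  ∀ K : Ideal R, J ≤ K → ∀ h : R, (∀ x, h * x ∈ K → x ∈ K) →
    ∀ n x, x ∈ J ^ n → h * x ∈ K * J ^ n → x ∈ K * J ^ n

/-- `f` acts injectively `J^n / K J^n → J^(n+1) / K J^(n+1)`. -/
def P (J : Ideal R) (f : R) : Prop :=
  ∀ K : Ideal R, J ≤ K → ∀ n x, x ∈ J ^ n → f * x ∈ K * J ^ (n + 1) → x ∈ K * J ^ n

lemma T.pow {J : Ideal R} (hT : T J) {g : R} (hg : ∀ x, g * x ∈ J → x ∈ J) (n : ℕ) :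
    ∀ x, g * x ∈ J ^ n → x ∈ J ^ n := by
  induction n with
  | zero => simp
  | succ n ih =>
    intro x hx
    rw [pow_succ'] at hx ⊢
    exact hT J le_rfl g hg n x (ih x (Ideal.mul_le_right hx)) hx

lemma T_bot : T (⊥ : Ideal R) := by
  intro K _ h hh n x hx hhx
  cases n with
  | zero => simpa using hh x (by simpa using hhx)
  | succ n =>
    have : x = 0 := by simpa [pow_succ] using hx
    simp [this]

section step
variable {J : Ideal R} {g : R}

lemma pow_mul_le {J I K : Ideal R} (hI : I ≤ K) (hJ : J ≤ I) (n : ℕ) :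
    J ^ (n + 1) ≤ K * I ^ n := by
  rw [pow_succ']
  exact Ideal.mul_mono (hJ.trans hI) (Ideal.pow_right_mono hJ n)

lemma mul_g_mem {I K : Ideal R} (hg : g ∈ I) {n : ℕ} {y : R} (hy : y ∈ K * I ^ n) :
    g * y ∈ K * I ^ (n + 1) := by
  rw [pow_succ', mul_left_comm]
  exact Ideal.mul_mem_mul hg hy

lemma T_step (hT : T J) (hg : ∀ x, g * x ∈ J → x ∈ J) : T (J ⊔ Ideal.span {g}) := by
  intro K hK h hh n
  have hJI : J ≤ J ⊔ Ideal.span {g} := le_sup_left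
  have hgI : g ∈ J ⊔ Ideal.span {g} := Ideal.mem_sup_right (Ideal.mem_span_singleton_self g)
  induction n with
  | zero => intro x _ hx; simpa using hh x (by simpa using hx)
  | succ n ih =>
    intro x hx hhx
    obtain ⟨j, hj, y, hy, rfl⟩ := decomp' J g n hx
    obtain ⟨a, ha, b, hb, hab⟩ := decomp K J g n hhx
    have h1 : h * y - b ∈ J ^ (n + 1) := by
      apply hT.pow hg
      have : g * (h * y - b) = a - h * j := by linear_combination hab
      rw [this]
      exact sub_mem ((Ideal.mul_le_right : K * J ^ (n + 1) ≤ J ^ (n + 1)) ha) (Ideal.mul_mem_left _ _ hj)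
    have h2 : y ∈ K * (J ⊔ Ideal.span {g}) ^ n := by
      apply ih y hy
      have := add_mem (pow_mul_le hK hJI n h1) hb
      simpa using this
    refine add_mem ?_ (mul_g_mem hgI h2)
    refine Ideal.mul_mono_right (Ideal.pow_right_mono hJI (n + 1)) ?_
    apply hT K (hJI.trans hK) h hh _ j hj
    have : h * j = a - g * (h * y - b) := by linear_combination hab
    rw [this]
    exact sub_mem ha (Ideal.mul_mem_mul (hK hgI) h1)

lemma P_new (hT : T J) (hg : ∀ x, g * x ∈ J → x ∈ J) : P (J ⊔ Ideal.span {g}) g := by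
  intro K hK n x hx hgx
  obtain ⟨a, ha, b, hb, hab⟩ := decomp K J g n hgx
  have h1 : x - b ∈ J ^ (n + 1) := by
    apply hT.pow hg
    have : g * (x - b) = a := by linear_combination hab
    rw [this]
    exact (Ideal.mul_le_right : K * J ^ (n + 1) ≤ J ^ (n + 1)) ha
  simpa using add_mem (pow_mul_le hK le_sup_left n h1) hb

lemma P_step (hT : T J) (hg : ∀ x, g * x ∈ J → x ∈ J) {f : R} (hf : f ∈ J) (hP : P J f) :
    P (J ⊔ Ideal.span {g}) f := by
  intro K hK n
  have hJI : J ≤ J ⊔ Ideal.span {g} := le_sup_left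
  have hgI : g ∈ J ⊔ Ideal.span {g} := Ideal.mem_sup_right (Ideal.mem_span_singleton_self g)
  have key : ∀ (n : ℕ) (j y : R), j ∈ J ^ n →
      f * (j + g * y) ∈ K * (J ⊔ Ideal.span {g}) ^ (n + 1) →
      f * y ∈ K * (J ⊔ Ideal.span {g}) ^ n ∧ j ∈ K * (J ⊔ Ideal.span {g}) ^ n := by
    intro n j y hj hx
    have hfj : f * j ∈ J ^ (n + 1) := by
      rw [pow_succ']; exact Ideal.mul_mem_mul hf hj
    obtain ⟨a, ha, b, hb, hab⟩ := decomp K J g n hx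
    have h1 : f * y - b ∈ J ^ (n + 1) := by
      apply hT.pow hg
      have : g * (f * y - b) = a - f * j := by linear_combination hab
      rw [this]
      exact sub_mem ((Ideal.mul_le_right : K * J ^ (n + 1) ≤ J ^ (n + 1)) ha) hfj
    refine ⟨by simpa using add_mem (pow_mul_le hK hJI n h1) hb, ?_⟩
    refine Ideal.mul_mono_right (Ideal.pow_right_mono hJI n) ?_
    apply hP K (hJI.trans hK) _ j hj
    have : f * j = a - g * (f * y - b) := by linear_combination hab
    rw [this]
    exact sub_mem ha (Ideal.mul_mem_mul (hK hgI) h1)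
  induction n with
  | zero =>
    intro x _ hfx
    exact (key 0 x 0 (by simp) (by simpa using hfx)).2
  | succ n ih =>
    intro x hx hfx
    obtain ⟨j, hj, y, hy, rfl⟩ := decomp' J g n hx
    obtain ⟨h1, h2⟩ := key _ j y hj hfx
    exact add_mem h2 (mul_g_mem hgI (ih y hy h1))

end step

lemma main_list (l : List R) (hl : RingTheory.Sequence.IsWeaklyRegular R l) :
    T (Ideal.ofList l) ∧ ∀ f ∈ l, P (Ideal.ofList l) f := by
  induction l using List.reverseRecOn with
  | nil => simpa using T_bot
  | append_singleton l g ih =>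
    rw [RingTheory.Sequence.isWeaklyRegular_append_iff,
      RingTheory.Sequence.isWeaklyRegular_singleton_iff] at hl
    obtain ⟨hT, hP⟩ := ih hl.1
    have hg : ∀ x, g * x ∈ Ideal.ofList l → x ∈ Ideal.ofList l := by
      have h := hl.2
      rw [isSMulRegular_quotient_iff_mem_of_smul_mem] at h
      intro x hx
      simpa using h x (by simpa using hx)
    rw [Ideal.ofList_append, Ideal.ofList_singleton]
    refine ⟨T_step hT hg, fun f hf => ?_⟩
    rcases List.mem_append.1 hf with hf | hf
    · exact P_step hT hg (Ideal.subset_span hf) (hP f hf)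
    · rw [List.mem_singleton.1 hf]; exact P_new hT hg

lemma P.colon {I : Ideal R} {f : R} (hP : P I f) (n : ℕ) :
    ∀ x, f * x ∈ I ^ (n + 1) → x ∈ I ^ n := by
  induction n with
  | zero => simp
  | succ n ih =>
    intro x hx
    rw [pow_succ']
    exact hP I le_rfl n x (ih x (Ideal.pow_le_pow_right (Nat.le_succ _) hx))
      (by rwa [← pow_succ'])

lemma P.colon_pow {I : Ideal R} {f : R} (hP : P I f) (k n : ℕ) :
    ∀ x, f ^ k * x ∈ I ^ (n + k) → x ∈ I ^ n := by
  induction k with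
  | zero => simp
  | succ k ih =>
    intro x hx
    refine ih x (hP.colon _ _ ?_)
    rwa [← mul_assoc, ← pow_succ']

lemma colon_prod {ι : Type*} {I : Ideal R} (f : ι → R) (hP : ∀ i, P I (f i)) (A : ι → ℕ)
    (s : Finset ι) : ∀ (n : ℕ) (x : R), (∏ i ∈ s, f i ^ A i) * x ∈ I ^ (n + ∑ i ∈ s, A i) →
      x ∈ I ^ n := by
  classical
  induction s using Finset.induction_on with
  | empty => simp
  | insert i s hi ih =>
    intro n x hx
    rw [Finset.prod_insert hi, Finset.sum_insert hi, mul_assoc] at hx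
    refine ih n x ((hP i).colon_pow (A i) _ _ ?_)
    rwa [add_assoc, add_comm (∑ i ∈ s, A i)]

end ColonPow


/-- Lemma 3.2: if `f₁, …, f_m` is a regular sequence generating the ideal `I`,
`A = (n₁, …, n_m)` is a tuple of nonnegative integers with `|A| = n₁ + ⋯ + n_m` and
`f^A = f₁^{n₁} ⋯ f_m^{n_m}`, then for every `n ≥ |A|` the quotient (colon) ideal
`(Iⁿ : (f^A))` equals `I^{n - |A|}`. -/
theorem colon_pow_regular_sequence {R : Type*} [CommRing R] {m : ℕ} (f : Fin m → R)
    (hreg : RingTheory.Sequence.IsRegular R (List.ofFn f))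
    (A : Fin m → ℕ) (n : ℕ) (hn : ∑ i, A i ≤ n) :
    Submodule.colon ((Ideal.span (Set.range f)) ^ n)
        (Ideal.span {∏ i, f i ^ A i}) =
      (Ideal.span (Set.range f)) ^ (n - ∑ i, A i) := by
  have hI : Ideal.span (Set.range f) = Ideal.ofList (List.ofFn f) := by
    unfold Ideal.ofList
    congr 1
    ext x
    simp [List.mem_ofFn]
  have hP : ∀ i, ColonPow.P (Ideal.span (Set.range f)) (f i) := by
    intro i
    rw [hI]
    exact (ColonPow.main_list _ hreg.toIsWeaklyRegular).2 _ (by simp [List.mem_ofFn])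
  obtain ⟨k, rfl⟩ := Nat.exists_eq_add_of_le hn
  rw [Nat.add_sub_cancel_left]
  ext x
  rw [Submodule.mem_colon]
  constructor
  · intro h
    apply ColonPow.colon_prod f hP A Finset.univ k x
    rw [mul_comm, add_comm k]
    exact h _ (Ideal.mem_span_singleton_self _)
  · intro hx p hp
    have hmem : (∏ i, f i ^ A i) ∈ Ideal.span (Set.range f) ^ (∑ i, A i) := by
      rw [← Finset.prod_pow_eq_pow_sum]
      exact Ideal.prod_mem_prod fun i _ =>
        Ideal.pow_mem_pow (Ideal.subset_span (Set.mem_range_self i)) _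
    have hp' := (Ideal.span_singleton_le_iff_mem _).2 hmem hp
    rw [smul_eq_mul, mul_comm, pow_add]
    exact Ideal.mul_mem_mul hp' hx
end

section
/- Let R be a commutative ring, let f₁,…,f_m ∈ R be a regular sequence, and let I = (f₁,…,f_m). Let A = (n₁,…,n_m) be an m-tuple of nonnegative integers, write |A| = n₁+⋯+n_m and f^A = f₁^{n₁}⋯f_m^{n_m}. Then for every nonnegative integer k, the element f^A lies in I^k if and only if k ≤ |A|. In particular, the largest nonnegative integer k with f^A ∈ I^k equals |A|. -/
namespace QR

variable {R : Type*} [CommRing R]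

/-- `J^n / 𝔞 J^n` has the same nonzerodivisors as `R / 𝔞`. -/
def S (J : Ideal R) : Prop :=
  ∀ (a : Ideal R), J ≤ a → ∀ g : R, (∀ x, g * x ∈ a → x ∈ a) →
    ∀ (n : ℕ) (x : R), x ∈ J ^ n → g * x ∈ a * J ^ n → x ∈ a * J ^ n

theorem mem_right {a J : Ideal R} {x : R} (hx : x ∈ a * J) : x ∈ J :=
  (Ideal.mul_le_right : a * J ≤ J) hx

theorem prod_mem {m : ℕ} (f : Fin m → R) (A : Fin m → ℕ) :
    (∏ i, f i ^ A i) ∈ Ideal.span (Set.range f) ^ (∑ i, A i) := by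
  rw [← Finset.prod_pow_eq_pow_sum]
  exact Ideal.prod_mem_prod fun i _ =>
    Ideal.pow_mem_pow (Ideal.subset_span (Set.mem_range_self i)) _

theorem pow_le (J : Ideal R) (e : R) (n : ℕ) :
    (J ⊔ Ideal.span {e}) ^ (n + 1) ≤
      Ideal.span {e} * (J ⊔ Ideal.span {e}) ^ n ⊔ J ^ (n + 1) := by
  induction n with
  | zero => simp
  | succ n ih =>
    set I := J ⊔ Ideal.span {e} with hI
    have hJ : J ≤ I := le_sup_left
    calc I ^ (n + 1 + 1) = I ^ (n + 1) * J ⊔ I ^ (n + 1) * Ideal.span {e} := by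
          rw [pow_succ I (n + 1), ← Ideal.mul_sup]
      _ ≤ _ := by
          refine sup_le ?_ ?_
          · refine (Ideal.mul_mono_left ih).trans ?_
            rw [Ideal.sup_mul, mul_assoc, ← pow_succ]
            refine sup_le_sup ?_ le_rfl
            rw [pow_succ I n]
            exact Ideal.mul_mono_right (Ideal.mul_mono_right hJ)
          · rw [mul_comm]
            exact le_sup_left

theorem decomp (a J : Ideal R) (e : R) (n : ℕ) (x : R)
    (hx : x ∈ a * (J ⊔ Ideal.span {e}) ^ (n + 1)) :
    ∃ w ∈ a * (J ⊔ Ideal.span {e}) ^ n, ∃ z ∈ a * J ^ (n + 1), x = e * w + z := by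
  have h := Ideal.mul_mono_right (I := a) (pow_le J e n) hx
  rw [Ideal.mul_sup, mul_left_comm] at h
  obtain ⟨y, hy, z, hz, rfl⟩ := Submodule.mem_sup.1 h
  obtain ⟨w, hw, rfl⟩ := Ideal.mem_span_singleton_mul.1 hy
  exact ⟨w, hw, z, hz, rfl⟩

theorem S.pow {J : Ideal R} (h : S J) {e : R} (he : ∀ x, e * x ∈ J → x ∈ J) (n : ℕ) (x : R)
    (hx : e * x ∈ J ^ n) : x ∈ J ^ n := by
  induction n with
  | zero => simp
  | succ n ih =>
    rw [pow_succ'] at hx ⊢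
    exact h J le_rfl e he n x (ih (mem_right hx)) hx

theorem pow_succ_le {J I a : Ideal R} (hJ : J ≤ I) (ha : I ≤ a) (n : ℕ) :
    J ^ (n + 1) ≤ a * I ^ n := by
  rw [pow_succ']
  exact Ideal.mul_mono (hJ.trans ha) (Ideal.pow_right_mono hJ n)

theorem S.step {J : Ideal R} (h : S J) {e : R} (he : ∀ x, e * x ∈ J → x ∈ J) :
    S (J ⊔ Ideal.span {e}) := by
  intro a ha g hg n
  have hJ : J ≤ J ⊔ Ideal.span {e} := le_sup_left
  have hea : e ∈ a := ha (Ideal.mem_sup_right (Ideal.mem_span_singleton_self e))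
  induction n with
  | zero => intro x _ hx; simpa using hg x (by simpa using hx)
  | succ n ih =>
    intro x hx hgx
    obtain ⟨u, hu, v, hv, rfl⟩ := decomp ⊤ J e n x (by simpa using hx)
    obtain ⟨w, hw, z, hz, hwz⟩ := decomp a J e n _ hgx
    rw [Ideal.top_mul] at hu hv
    have ht : g * u - w ∈ J ^ (n + 1) := by
      apply h.pow he
      have : e * (g * u - w) = z - g * v := by linear_combination hwz
      rw [this]
      exact sub_mem (mem_right hz) (Ideal.mul_mem_left _ _ hv)
    have hu' : u ∈ a * (J ⊔ Ideal.span {e}) ^ n := by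
      apply ih u hu
      have := add_mem (pow_succ_le hJ ha n ht) hw
      simpa using this
    have hv' : v ∈ a * J ^ (n + 1) := by
      apply h a (hJ.trans ha) g hg _ v hv
      have : g * v = z - e * (g * u - w) := by linear_combination hwz
      rw [this]
      exact sub_mem hz (Ideal.mul_mem_mul hea ht)
    refine add_mem ?_ (Ideal.mul_mono_right (Ideal.pow_right_mono hJ _) hv')
    rw [pow_succ', mul_left_comm]
    exact Ideal.mul_mem_mul (Ideal.mem_sup_right (Ideal.mem_span_singleton_self e)) hu'

/-- Elementary form of weak regularity. -/
def WR : (m : ℕ) → (Fin m → R) → Prop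
  | 0, _ => True
  | m + 1, f => WR m (fun i => f i.castSucc) ∧
      ∀ x, f (Fin.last m) * x ∈ Ideal.span (Set.range fun i : Fin m => f i.castSucc) →
        x ∈ Ideal.span (Set.range fun i : Fin m => f i.castSucc)

theorem span_succ {m : ℕ} (f : Fin (m + 1) → R) :
    Ideal.span (Set.range f) =
      Ideal.span (Set.range fun i : Fin m => f i.castSucc) ⊔ Ideal.span {f (Fin.last m)} := by
  rw [← Ideal.span_union]
  congr 1
  ext x
  simp [Fin.exists_fin_succ', or_comm, eq_comm]

theorem ofList_ofFn {m : ℕ} (f : Fin m → R) :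
    Ideal.ofList (List.ofFn f) = Ideal.span (Set.range f) := by
  unfold Ideal.ofList
  congr 1
  ext x
  simp [List.mem_ofFn]

theorem WR.of {m : ℕ} (f : Fin m → R)
    (h : RingTheory.Sequence.IsWeaklyRegular R (List.ofFn f)) : WR m f := by
  induction m with
  | zero => trivial
  | succ m ih =>
    rw [List.ofFn_succ', List.concat_eq_append,
      RingTheory.Sequence.isWeaklyRegular_append_iff] at h
    refine ⟨ih _ h.1, fun x hx => ?_⟩
    have h2 := h.2
    rw [RingTheory.Sequence.isWeaklyRegular_singleton_iff, ofList_ofFn,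
      isSMulRegular_quotient_iff_mem_of_smul_mem] at h2
    simpa using h2 x (by simpa using hx)

theorem WR.S {m : ℕ} (f : Fin m → R) (h : WR m f) : S (Ideal.span (Set.range f)) := by
  induction m with
  | zero =>
    intro a _ g hg n x hx hgx
    cases n with
    | zero => simpa using hg x (by simpa using hgx)
    | succ n =>
      have : x = 0 := by simpa [pow_succ] using hx
      simp [this]
  | succ m ih =>
    rw [span_succ]
    exact (ih _ h.1).step h.2

theorem WR.T {m : ℕ} (f : Fin m → R) (h : WR m f) (A : Fin m → ℕ) (a : Ideal R)
    (ha : Ideal.span (Set.range f) ≤ a)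
    (hA : (∏ i, f i ^ A i) ∈ a * Ideal.span (Set.range f) ^ (∑ i, A i)) : a = ⊤ := by
  induction m with
  | zero => exact (Ideal.eq_top_iff_one a).2 (by simpa using hA)
  | succ m ih =>
    rw [span_succ] at hA ha
    rw [Fin.prod_univ_castSucc, Fin.sum_univ_castSucc] at hA
    have hS := WR.S _ h.1
    have he := h.2
    have ih' := ih _ h.1 (fun i => A i.castSucc)
    set J := Ideal.span (Set.range fun i : Fin m => f i.castSucc) with hJdef
    set e := f (Fin.last m)
    set s := ∑ i : Fin m, A i.castSucc
    have hp : ∏ i : Fin m, f i.castSucc ^ A i.castSucc ∈ J ^ s :=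
      prod_mem (fun i : Fin m => f i.castSucc) (fun i => A i.castSucc)
    set p := ∏ i : Fin m, f i.castSucc ^ A i.castSucc
    have hJ : J ≤ J ⊔ Ideal.span {e} := le_sup_left
    have hea : e ∈ a := ha (Ideal.mem_sup_right (Ideal.mem_span_singleton_self e))
    generalize A (Fin.last m) = b at hA
    induction b with
    | zero =>
      apply ih' (hJ.trans ha)
      rw [pow_zero, mul_one, add_zero] at hA
      clear_value s
      cases s with
      | zero => simpa using hA
      | succ n =>
        obtain ⟨w, hw, z, hz, hwz⟩ := decomp a J e n _ hA
        have hw' : w ∈ J ^ (n + 1) := by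
          apply hS.pow he
          have : e * w = p - z := by linear_combination -hwz
          rw [this]
          exact sub_mem hp (mem_right hz)
        rw [hwz]
        exact add_mem (Ideal.mul_mem_mul hea hw') hz
    | succ b ihb =>
      apply ihb
      rw [← add_assoc] at hA
      obtain ⟨w, hw, z, hz, hwz⟩ := decomp a J e _ _ hA
      have ht : p * e ^ b - w ∈ J ^ (s + b + 1) := by
        apply hS.pow he
        have : e * (p * e ^ b - w) = z := by linear_combination hwz
        rw [this]
        exact mem_right hz
      have := add_mem (pow_succ_le hJ ha _ ht) hw
      simpa using this

end QR

/-- If `f₁, …, f_m` is a regular sequence generating the ideal `I`, and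
`f^A = f₁^{n₁} ⋯ f_m^{n_m}` with `|A| = n₁ + ⋯ + n_m`, then for every nonnegative
integer `k`, `f^A ∈ I^k` if and only if `k ≤ |A|`; in particular, the largest `k`
with `f^A ∈ I^k` is `|A|`. -/
theorem pow_prod_mem_pow_ideal_iff {R : Type*} [CommRing R] {m : ℕ} (f : Fin m → R)
    (hreg : RingTheory.Sequence.IsRegular R (List.ofFn f))
    (A : Fin m → ℕ) :
    (∀ k : ℕ, (∏ i, f i ^ A i) ∈ (Ideal.span (Set.range f)) ^ k ↔ k ≤ ∑ i, A i) ∧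
    IsGreatest {k : ℕ | (∏ i, f i ^ A i) ∈ (Ideal.span (Set.range f)) ^ k}
      (∑ i, A i) := by
  have key : ∀ k : ℕ, (∏ i, f i ^ A i) ∈ (Ideal.span (Set.range f)) ^ k ↔ k ≤ ∑ i, A i := by
    intro k
    constructor
    · intro hk
      by_contra hlt
      have hlt' : (∑ i, A i) + 1 ≤ k := by omega
      have h1 := Ideal.pow_le_pow_right hlt' hk
      rw [pow_succ'] at h1
      have htop := QR.WR.T f (QR.WR.of f hreg.toIsWeaklyRegular) A _ le_rfl h1
      apply hreg.top_ne_smul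
      rw [QR.ofList_ofFn, htop]
      simp
    · intro hk
      exact Ideal.pow_le_pow_right hk (QR.prod_mem f A)
  exact ⟨key, (key _).2 le_rfl, fun k hk => (key k).1 hk⟩
end

section
/- Let R be a commutative ring, let f₁,…,f_m ∈ R be a regular sequence, and let I = (f₁,…,f_m). Let A = (n₁,…,n_m) be an m-tuple of nonnegative integers, write |A| = n₁+⋯+n_m and f^A = f₁^{n₁}⋯f_m^{n_m}. Suppose g ∈ R satisfies g ∈ I^s and g ∉ I^{s+1} for some nonnegative integer s. Then f^A·g ∈ I^{|A|+s} and f^A·g ∉ I^{|A|+s+1}. In other words, the I-adic order of f^A·g equals |A| plus the I-adic order of g. -/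
namespace OrderAux
open MvPolynomial

variable {R : Type*} [CommRing R] {σ : Type*}

/-- `F` is a form of degree `n` in the variables from `S`. -/
def Form (S : Set σ) (n : ℕ) (F : MvPolynomial σ R) : Prop :=
  ∀ d, coeff d F ≠ 0 → (∀ i, i ∉ S → d i = 0) ∧ d.degree = n

lemma Form.add {S : Set σ} {n : ℕ} {F G : MvPolynomial σ R} (hF : Form S n F) (hG : Form S n G) :
    Form S n (F + G) := by
  intro d hd
  by_cases h : coeff d F = 0
  · apply hG d
    intro h'
    simp [h, h'] at hd
  · exact hF d h

lemma Form.C_mul {S : Set σ} {n : ℕ} {F : MvPolynomial σ R} (hF : Form S n F) (c : R) :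
    Form S n (C c * F) := by
  intro d hd
  apply hF d
  intro h
  simp [coeff_C_mul, h] at hd

lemma Form.sub {S : Set σ} {n : ℕ} {F G : MvPolynomial σ R} (hF : Form S n F) (hG : Form S n G) :
    Form S n (F - G) := by
  have := hF.add (hG.C_mul (-1))
  simpa [sub_eq_add_neg] using this

lemma Form.mul_X {S : Set σ} {n : ℕ} {F : MvPolynomial σ R} (hF : Form S n F) {i : σ}
    (hi : i ∈ S) : Form S (n + 1) (F * X i) := by
  classical
  intro d hd
  rw [coeff_mul_X'] at hd
  split_ifs at hd with h
  · obtain ⟨h1, h2⟩ := hF _ hd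
    have hle : Finsupp.single i 1 ≤ d := by
      rw [Finsupp.single_le_iff]
      have := Finsupp.mem_support_iff.1 h
      omega
    have he : d - Finsupp.single i 1 + Finsupp.single i 1 = d := tsub_add_cancel_of_le hle
    refine ⟨fun j hj => ?_, ?_⟩
    · have hij : i ≠ j := fun h => hj (h ▸ hi)
      rw [← he]
      simp [h1 j hj, Finsupp.single_apply, hij] 
      have := h1 j hj
      simpa [Finsupp.single_apply, hij] using this
    · rw [← he, map_add, h2, Finsupp.degree_single]
  · exact absurd rfl hd

lemma exists_form (f : σ → R) (S : Set σ) (K : Ideal R) (n : ℕ) :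
    ∀ x ∈ K * Ideal.span (f '' S) ^ n, ∃ F : MvPolynomial σ R,
      Form S n F ∧ (∀ d, coeff d F ∈ K) ∧ eval f F = x := by
  classical
  induction n with
  | zero =>
    intro x hx
    simp only [pow_zero, mul_one] at hx
    refine ⟨C x, ?_, ?_, by simp⟩
    · intro d hd
      rw [coeff_C] at hd
      split_ifs at hd with h
      · subst h; simp
      · exact absurd rfl hd
    · intro d
      rw [coeff_C]
      split_ifs
      · exact hx
      · exact K.zero_mem
  | succ n ih =>
    intro x hx
    rw [pow_succ, ← mul_assoc] at hx
    refine Submodule.mul_induction_on hx ?_ ?_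
    · intro y hy z hz
      obtain ⟨F, hF, hK, rfl⟩ := ih y hy
      refine Submodule.span_induction ?_ ?_ ?_ ?_ hz
      · rintro _ ⟨i, hi, rfl⟩
        refine ⟨F * X i, hF.mul_X hi, fun d => ?_, by simp⟩
        rw [coeff_mul_X']
        split_ifs
        · exact hK _
        · exact K.zero_mem
      · exact ⟨0, by intro d hd; simp at hd, by simp, by simp⟩
      · rintro a b - - ⟨A, hA, hA', ha⟩ ⟨B, hB, hB', hb⟩
        exact ⟨A + B, hA.add hB, fun d => by rw [coeff_add]; exact K.add_mem (hA' d) (hB' d),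
          by rw [map_add, ha, hb]; ring⟩
      · rintro a b - ⟨B, hB, hB', hb⟩
        exact ⟨C a * B, hB.C_mul a, fun d => by rw [coeff_C_mul]; exact K.mul_mem_left _ (hB' d),
          by rw [map_mul, hb, eval_C, smul_eq_mul]; ring⟩
    · rintro a b ⟨A, hA, hA', ha⟩ ⟨B, hB, hB', hb⟩
      exact ⟨A + B, hA.add hB, fun d => by rw [coeff_add]; exact K.add_mem (hA' d) (hB' d),
          by rw [map_add, ha, hb]⟩

lemma eval_mem (f : σ → R) (S : Set σ) (K : Ideal R) (n : ℕ) (F : MvPolynomial σ R)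
    (hF : Form S n F) (hK : ∀ d, coeff d F ∈ K) : eval f F ∈ K * Ideal.span (f '' S) ^ n := by
  rw [eval_eq]
  refine Ideal.sum_mem _ fun d hd => Ideal.mul_mem_mul (hK d) ?_
  obtain ⟨h1, h2⟩ := hF d (mem_support_iff.1 hd)
  rw [← h2, Finsupp.degree_apply, ← Finset.prod_pow_eq_pow_sum]
  refine Ideal.prod_mem_prod fun i hi => ?_
  have hiS : i ∈ S := by
    by_contra h
    exact Finsupp.mem_support_iff.1 hi (h1 i h)
  exact Ideal.pow_mem_pow (Ideal.subset_span (Set.mem_image_of_mem f hiS)) _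

/-- Quasi-regularity. -/
def QR (f : σ → R) (S : Set σ) : Prop :=
  ∀ n (F : MvPolynomial σ R), Form S n F → eval f F ∈ Ideal.span (f '' S) ^ (n + 1) →
    ∀ d, coeff d F ∈ Ideal.span (f '' S)

lemma nzd_pow {f : σ → R} {S : Set σ} (h : QR f S) {x : R}
    (hx : ∀ r, x * r ∈ Ideal.span (f '' S) → r ∈ Ideal.span (f '' S)) (v : ℕ) :
    ∀ r, x * r ∈ Ideal.span (f '' S) ^ v → r ∈ Ideal.span (f '' S) ^ v := by
  induction v with
  | zero => simp
  | succ v ih =>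
    intro r hr
    have h1 := ih r (Ideal.pow_le_pow_right (Nat.le_succ v) hr)
    obtain ⟨F, hF, -, rfl⟩ := exists_form f S ⊤ v r (by simpa using h1)
    have h2 := h v (C x * F) (hF.C_mul x) (by simpa using hr)
    have := eval_mem f S _ v F hF fun d => hx _ (by simpa [coeff_C_mul] using h2 d)
    rwa [pow_succ']

lemma QR_empty (f : σ → R) : QR f ∅ := by
  classical
  intro n F hF h d
  have e : F = C (coeff 0 F) := by
    ext d
    rw [coeff_C]
    split_ifs with h
    · rw [h]
    · by_contra h'
      apply h
      ext i
      simp [(hF d h').1 i (by simp)]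
  rw [e] at h ⊢
  simp only [Set.image_empty, Ideal.span_empty, eval_C] at h ⊢
  have h0 : coeff 0 F = 0 := by
    have := Ideal.pow_le_self (Nat.succ_ne_zero n) h
    simpa using this
  simp [h0]

lemma QR_insert {f : σ → R} {S : Set σ} (h : QR f S) {a : σ} (ha : a ∉ S)
    (hx : ∀ r, f a * r ∈ Ideal.span (f '' S) → r ∈ Ideal.span (f '' S)) :
    QR f (insert a S) := by
  classical
  have hJI : Ideal.span (f '' S) ≤ Ideal.span (f '' insert a S) :=
    Ideal.span_mono (Set.image_mono (Set.subset_insert a S))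
  have haI : f a ∈ Ideal.span (f '' insert a S) :=
    Ideal.subset_span ⟨a, Set.mem_insert _ _, rfl⟩
  intro n
  induction n with
  | zero =>
    intro F hF hI d
    by_cases hd : coeff d F = 0
    · rw [hd]; exact Ideal.zero_mem _
    have e : F = C (coeff 0 F) := by
      ext d
      rw [coeff_C]
      split_ifs with h
      · rw [h]
      · by_contra h'
        have := (hF d h').2
        rw [Finsupp.degree_eq_zero_iff] at this
        exact h this.symm
    have hd0 := (hF d hd).2
    rw [Finsupp.degree_eq_zero_iff] at hd0
    subst hd0
    rw [e] at hI
    simpa using hI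
  | succ n ih =>
    intro F₀ hF₀ hI
    rw [pow_succ'] at hI
    obtain ⟨F₁, hF₁, hc, he⟩ := exists_form f (insert a S) _ _ _ hI
    obtain ⟨F, hFdef⟩ : ∃ F, F = F₀ - F₁ := ⟨_, rfl⟩
    have hF : Form (insert a S) (n + 1) F := hFdef ▸ hF₀.sub hF₁
    have hF0 : eval f F = 0 := by rw [hFdef, map_sub, he, sub_self]
    suffices H : ∀ d, coeff d F ∈ Ideal.span (f '' insert a S) by
      intro d
      have := Ideal.add_mem _ (H d) (hc d)
      rwa [hFdef, coeff_sub, sub_add_cancel] at this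
    obtain ⟨H, hH⟩ : ∃ H, H = F.divMonomial (Finsupp.single a 1) := ⟨_, rfl⟩
    obtain ⟨G, hG⟩ : ∃ G, G = F.modMonomial (Finsupp.single a 1) := ⟨_, rfl⟩
    have hdec : X a * H + G = F := by rw [hH, hG]; exact divMonomial_add_modMonomial_single F a
    have hHf : Form (insert a S) n H := by
      intro d hd
      rw [hH, coeff_divMonomial] at hd
      obtain ⟨h1, h2⟩ := hF _ hd
      refine ⟨fun i hi => ?_, ?_⟩
      · have := h1 i hi
        simp at this
        exact this.2
      · rw [map_add, Finsupp.degree_single] at h2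
        omega
    have hGf : Form S (n + 1) G := by
      intro d hd
      by_cases hle : Finsupp.single a 1 ≤ d
      · rw [hG, coeff_modMonomial_of_le _ hle] at hd
        exact absurd rfl hd
      · rw [hG, coeff_modMonomial_of_not_le _ hle] at hd
        obtain ⟨h1, h2⟩ := hF _ hd
        refine ⟨fun i hi => ?_, h2⟩
        by_cases hia : i = a
        · subst hia
          rw [Finsupp.single_le_iff] at hle
          omega
        · exact h1 i (by simp [hia, hi])
    have hGe : eval f G ∈ Ideal.span (f '' S) ^ (n + 1) := by
      have := eval_mem f S ⊤ (n + 1) G hGf (by simp)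
      simpa using this
    have hev : f a * eval f H + eval f G = 0 := by
      rw [← hF0, ← hdec]; simp
    have hHe : eval f H ∈ Ideal.span (f '' S) ^ (n + 1) := by
      apply nzd_pow h hx
      rw [eq_neg_of_add_eq_zero_left hev]
      exact neg_mem hGe
    have hHc := ih H hHf (Ideal.pow_right_mono hJI _ hHe)
    obtain ⟨k, hk, -, hke⟩ := exists_form f S ⊤ (n + 1) (eval f H) (by simpa using hHe)
    have hGk := h (n + 1) (C (f a) * k + G) ((hk.C_mul _).add hGf) (by
      simp [hke, hev])
    intro d
    have hGd : coeff d G ∈ Ideal.span (f '' insert a S) := by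
      have h1 := hJI (hGk d)
      rw [coeff_add, coeff_C_mul] at h1
      exact (Ideal.add_mem_iff_right _ (Ideal.mul_mem_right _ _ haI)).1 h1
    rw [← hdec, coeff_add]
    refine Ideal.add_mem _ ?_ hGd
    rw [coeff_X_mul']
    split_ifs
    · exact hHc _
    · exact Ideal.zero_mem _

lemma QR_of_regular {m : ℕ} (f : Fin m → R)
    (hreg : ∀ i : Fin m, ∀ r, f i * r ∈ Ideal.span (f '' {j | j < i}) →
      r ∈ Ideal.span (f '' {j | j < i})) : QR f Set.univ := by
  have key : ∀ k, k ≤ m → QR f {j : Fin m | j.val < k} := by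
    intro k
    induction k with
    | zero => intro _; simpa using QR_empty f
    | succ k ih =>
      intro hk
      have e : {j : Fin m | j.val < k + 1} = insert ⟨k, hk⟩ {j : Fin m | j.val < k} := by
        ext j
        simp [Fin.ext_iff]
        omega
      rw [e]
      exact QR_insert (ih (by omega)) (by simp) (hreg ⟨k, hk⟩)
  have := key m le_rfl
  simpa using this

lemma mul_cancel {m : ℕ} {f : Fin m → R} (h : QR f Set.univ) (i : Fin m) (n : ℕ) :
    ∀ g, f i * g ∈ Ideal.span (Set.range f) ^ (n + 1) → g ∈ Ideal.span (Set.range f) ^ n := by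
  rw [← Set.image_univ]
  induction n with
  | zero => simp
  | succ n ih =>
    intro g hg
    have h1 := ih g (Ideal.pow_le_pow_right (Nat.le_succ _) hg)
    obtain ⟨F, hF, -, rfl⟩ := exists_form f Set.univ ⊤ n g (by simpa using h1)
    have h2 := h (n + 1) (F * X i) (hF.mul_X (Set.mem_univ i)) (by
      simpa [mul_comm] using hg)
    have := eval_mem f Set.univ _ n F hF fun d => by
      have := h2 (d + Finsupp.single i 1)
      rwa [coeff_mul_X] at this
    rwa [pow_succ']

lemma regular_aux {m : ℕ} (f : Fin m → R)
    (hreg : RingTheory.Sequence.IsWeaklyRegular R (List.ofFn f)) (i : Fin m) (r : R)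
    (h : f i * r ∈ Ideal.span (f '' {j | j < i})) : r ∈ Ideal.span (f '' {j | j < i}) := by
  have h1 := hreg.regular_mod_prev i.val (by simp)
  have e : Ideal.ofList ((List.ofFn f).take i.val) = Ideal.span (f '' {j | j < i}) := by
    unfold Ideal.ofList
    congr 1
    ext x
    simp only [Set.mem_setOf_eq, List.mem_take_iff_getElem, Set.mem_image]
    constructor
    · rintro ⟨j, hj, rfl⟩
      simp at hj
      exact ⟨⟨j, by omega⟩, by simp [Fin.lt_def]; omega, by simp⟩
    · rintro ⟨j, hj, rfl⟩
      exact ⟨j.val, by simp; exact hj, by simp⟩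
  rw [e] at h1
  have h2 := isSMulRegular_iff_right_eq_zero_of_smul.1 h1 (Submodule.Quotient.mk r) (by
    rw [← Submodule.Quotient.mk_smul, Submodule.Quotient.mk_eq_zero]
    simpa using h)
  rw [Submodule.Quotient.mk_eq_zero] at h2
  simpa using h2

lemma pow_cancel {m : ℕ} {f : Fin m → R} (h : QR f Set.univ) (i : Fin m) (a n : ℕ) :
    ∀ g, f i ^ a * g ∈ Ideal.span (Set.range f) ^ (a + n) → g ∈ Ideal.span (Set.range f) ^ n := by
  induction a with
  | zero => simp
  | succ a ih =>
    intro g hg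
    apply ih
    apply mul_cancel h i
    have e1 : f i * (f i ^ a * g) = f i ^ (a + 1) * g := by ring
    have e2 : a + n + 1 = a + 1 + n := by omega
    rw [e1, e2]
    exact hg

lemma prod_cancel {m : ℕ} {f : Fin m → R} (h : QR f Set.univ) (A : Fin m → ℕ)
    (T : Finset (Fin m)) (n : ℕ) :
    ∀ g, (∏ i ∈ T, f i ^ A i) * g ∈ Ideal.span (Set.range f) ^ ((∑ i ∈ T, A i) + n) →
      g ∈ Ideal.span (Set.range f) ^ n := by
  induction T using Finset.induction_on with
  | empty => simp
  | insert a T ha ih =>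
    intro g hg
    rw [Finset.prod_insert ha, Finset.sum_insert ha, mul_assoc, add_assoc] at hg
    exact ih _ (pow_cancel h _ _ _ _ hg)

end OrderAux

/-- Local-ring content of Lemma 3.4(i): if `f₁, …, f_m` is a regular sequence
generating `I`, `f^A = f₁^{n₁} ⋯ f_m^{n_m}` with `|A| = n₁ + ⋯ + n_m`, and `g` has
`I`-adic order exactly `s` (i.e. `g ∈ I^s`, `g ∉ I^{s+1}`), then `f^A · g` has
`I`-adic order exactly `|A| + s`. -/
theorem order_mul_pow_prod {R : Type*} [CommRing R] {m : ℕ} (f : Fin m → R)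
    (hreg : RingTheory.Sequence.IsRegular R (List.ofFn f))
    (A : Fin m → ℕ) (g : R) (s : ℕ)
    (hgs : g ∈ (Ideal.span (Set.range f)) ^ s)
    (hgs' : g ∉ (Ideal.span (Set.range f)) ^ (s + 1)) :
    (∏ i, f i ^ A i) * g ∈ (Ideal.span (Set.range f)) ^ ((∑ i, A i) + s) ∧
    (∏ i, f i ^ A i) * g ∉ (Ideal.span (Set.range f)) ^ ((∑ i, A i) + s + 1) := by
  refine ⟨?_, fun h => hgs' ?_⟩
  · rw [pow_add]
    refine Ideal.mul_mem_mul ?_ hgs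
    rw [← Finset.prod_pow_eq_pow_sum]
    exact Ideal.prod_mem_prod fun i _ =>
      Ideal.pow_mem_pow (Ideal.subset_span (Set.mem_range_self i)) _
  · have hq := OrderAux.QR_of_regular f (OrderAux.regular_aux f hreg.toIsWeaklyRegular)
    exact OrderAux.prod_cancel hq A Finset.univ (s + 1) g h
end

section
/- Let R be a commutative ring, let f₁,…,f_m ∈ R be a regular sequence, and let I = (f₁,…,f_m). Let A = (n₁,…,n_m) be an m-tuple of nonnegative integers, write |A| = n₁+⋯+n_m and f^A = f₁^{n₁}⋯f_m^{n_m}. Let α be a positive integer, and suppose g ∈ R satisfies g ∈ I^s and g ∉ I^{s+1} for some nonnegative integer s. For h ∈ R define n_α(h) to be the largest nonnegative integer n such that h ∈ I^{αn} (when it exists). Then n_α(f^A) = ⌊|A|/α⌋, n_α(g) = ⌊s/α⌋, n_α(f^A·g) = ⌊(|A|+s)/α⌋, and consequently −2 < n_α(f^A·g) − n_α(f^A) − n_α(g) < 2. -/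
namespace NAlpha

open MvPolynomial

variable {R : Type*} [CommRing R] {m : ℕ}

/-- The ideal generated by the first `k` entries. -/
def J (f : Fin m → R) (k : ℕ) : Ideal R := Ideal.span (f '' {i | i.val < k})

/-- `F` is homogeneous of degree `n` in the first `k` variables. -/
def Hom (k n : ℕ) (F : MvPolynomial (Fin m) R) : Prop :=
  ∀ d, coeff d F ≠ 0 → (∀ i : Fin m, k ≤ i.val → d i = 0) ∧ d.degree = n

lemma Hom.add {k n : ℕ} {F G : MvPolynomial (Fin m) R} (hF : Hom k n F) (hG : Hom k n G) :
    Hom k n (F + G) := by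
  intro d hd
  rw [coeff_add] at hd
  by_cases h : coeff d F = 0
  · exact hG d (by simpa [h] using hd)
  · exact hF d h

lemma Hom.C_mul {k n : ℕ} {F : MvPolynomial (Fin m) R} (hF : Hom k n F) (a : R) :
    Hom k n (C a * F) := by
  intro d hd
  rw [coeff_C_mul] at hd
  exact hF d (right_ne_zero_of_mul hd)

lemma Hom.zero {k n : ℕ} : Hom k n (0 : MvPolynomial (Fin m) R) := by
  intro d hd
  simp at hd

lemma Hom.X_mul {k n : ℕ} {F : MvPolynomial (Fin m) R} (hF : Hom k n F) (i : Fin m)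
    (hi : i.val < k) : Hom k (n + 1) (X i * F) := by
  intro d hd
  rw [coeff_X_mul'] at hd
  split_ifs at hd with h
  · have hle : Finsupp.single i 1 ≤ d := by
      rw [Finsupp.single_le_iff]
      exact Nat.one_le_iff_ne_zero.mpr (by simpa using h)
    obtain ⟨e, rfl⟩ := exists_add_of_le hle
    rw [add_tsub_cancel_left] at hd
    obtain ⟨h1, h2⟩ := hF e hd
    refine ⟨fun j hj => ?_, ?_⟩
    · have : i ≠ j := by rintro rfl; omega
      simp [h1 j hj, this]
    · rw [map_add, h2, Finsupp.degree_single, add_comm]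
  · simp at hd

lemma eval_mem (f : Fin m → R) {k n : ℕ} {F : MvPolynomial (Fin m) R} (hF : Hom k n F)
    (K : Ideal R) (hK : ∀ d, coeff d F ∈ K) : eval f F ∈ K * J f k ^ n := by
  rw [eval_eq]
  refine Ideal.sum_mem _ fun d hd => Ideal.mul_mem_mul (hK d) ?_
  obtain ⟨h1, h2⟩ := hF d (by simpa using hd)
  have hsum : ∏ i ∈ d.support, J f k ^ d i = J f k ^ n := by
    rw [Finset.prod_pow_eq_pow_sum, ← h2, Finsupp.degree_apply]
  rw [← hsum]
  refine Ideal.prod_mem_prod fun i hi => ?_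
  have hik : i.val < k → f i ∈ J f k := fun h => Ideal.subset_span ⟨i, h, rfl⟩
  refine Ideal.pow_mem_pow (hik ?_) _
  by_contra hlt
  exact (by simpa using hi : d i ≠ 0) (h1 i (by simpa using hlt))

lemma exists_hom (f : Fin m → R) (k n : ℕ) : ∀ x ∈ J f k ^ n, ∃ F, Hom k n F ∧ eval f F = x := by
  induction n with
  | zero =>
    intro x _
    refine ⟨C x, ?_, by simp⟩
    intro d hd
    rw [coeff_C] at hd
    split_ifs at hd with h
    · subst h; simp
    · simp at hd
  | succ n ih =>
    intro x hx
    rw [pow_succ'] at hx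
    refine Submodule.mul_induction_on hx ?_ ?_
    · intro a ha b hb
      obtain ⟨F, hF, rfl⟩ := ih b hb
      refine Submodule.span_induction (p := fun a _ => ∃ G, Hom k (n + 1) G ∧ eval f G = a * eval f F)
        ?_ ?_ ?_ ?_ ha
      · rintro _ ⟨i, hi, rfl⟩
        exact ⟨X i * F, hF.X_mul i hi, by simp⟩
      · exact ⟨0, Hom.zero, by simp⟩
      · rintro a b _ _ ⟨G, hG, h1⟩ ⟨G', hG', h2⟩
        exact ⟨G + G', hG.add hG', by simp [h1, h2, add_mul]⟩
      · rintro r a _ ⟨G, hG, h1⟩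
        exact ⟨C r * G, hG.C_mul r, by simp [h1, mul_assoc]⟩
    · rintro a b ⟨G, hG, h1⟩ ⟨G', hG', h2⟩
      exact ⟨G + G', hG.add hG', by simp [h1, h2]⟩

lemma exists_hom_coeff (f : Fin m → R) (k n : ℕ) (x : R) (hx : x ∈ J f k ^ (n + 1)) :
    ∃ F, Hom k n F ∧ (∀ d, coeff d F ∈ J f k) ∧ eval f F = x := by
  rw [pow_succ'] at hx
  refine Submodule.mul_induction_on hx ?_ ?_
  · intro a ha b hb
    obtain ⟨F, hF, rfl⟩ := exists_hom f k n b hb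
    refine ⟨C a * F, hF.C_mul a, fun d => ?_, by simp⟩
    rw [coeff_C_mul]
    exact Ideal.mul_mem_right _ _ ha
  · rintro a b ⟨G, hG, hc, h1⟩ ⟨G', hG', hc', h2⟩
    exact ⟨G + G', hG.add hG', fun d => by rw [coeff_add]; exact add_mem (hc d) (hc' d),
      by simp [h1, h2]⟩

/-- Quasi-regularity of the first `k` elements in degree `n`. -/
def QR (f : Fin m → R) (k n : ℕ) : Prop :=
  ∀ F, Hom k n F → eval f F ∈ J f k ^ (n + 1) → ∀ d, coeff d F ∈ J f k

lemma QR_of (f : Fin m → R) (k n : ℕ)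
    (h : ∀ F, Hom k n F → eval f F = 0 → ∀ d, coeff d F ∈ J f k) : QR f k n := by
  intro F hF hx d
  obtain ⟨G, hG, hc, he⟩ := exists_hom_coeff f k n _ hx
  have := h (F + C (-1) * G) (hF.add (hG.C_mul _)) (by simp [he]) d
  rw [coeff_add, coeff_C_mul] at this
  have h2 := add_mem this (hc d)
  simpa using h2

lemma regular_pow (f : Fin m → R) (k : ℕ) (hQ : ∀ n, QR f k n) (a : R)
    (ha : ∀ x, a * x ∈ J f k → x ∈ J f k) (n : ℕ) (x : R) (hx : a * x ∈ J f k ^ n) :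
    x ∈ J f k ^ n := by
  suffices h : ∀ l, l ≤ n → x ∈ J f k ^ l from h n le_rfl
  intro l
  induction l with
  | zero => simp
  | succ l ih =>
    intro hl
    obtain ⟨F, hF, rfl⟩ := exists_hom f k l x (ih (by omega))
    rw [pow_succ']
    refine eval_mem f hF _ fun d => ha _ ?_
    rw [← coeff_C_mul]
    refine hQ l _ (hF.C_mul a) ?_ d
    simpa using Ideal.pow_le_pow_right hl hx

lemma J_mono (f : Fin m → R) {k l : ℕ} (h : k ≤ l) : J f k ≤ J f l :=
  Ideal.span_mono (Set.image_mono fun _ hi => lt_of_lt_of_le hi h)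

lemma const_case (f : Fin m → R) (F : MvPolynomial (Fin m) R) (hF : ∀ d, coeff d F ≠ 0 → d = 0)
    (he : eval f F = 0) (d) : coeff d F = 0 := by
  have h : F = C (coeff 0 F) := by
    ext e
    rw [coeff_C]
    split_ifs with h
    · rw [h]
    · by_contra h2
      exact h (hF e h2).symm
  have h0 : coeff 0 F = 0 := by
    rw [h] at he
    simpa using he
  rw [h, h0]
  simp

lemma qr_all (f : Fin m → R)
    (hreg : ∀ i : Fin m, ∀ x, f i * x ∈ J f i.val → x ∈ J f i.val) (k : ℕ) (hk : k ≤ m) :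
    ∀ n, QR f k n := by
  induction k with
  | zero =>
    intro n
    refine QR_of f 0 n fun F hF he d => ?_
    rw [const_case f F (fun d hd => ?_) he d]
    · exact zero_mem _
    · ext i
      exact (hF d hd).1 i (Nat.zero_le _)
  | succ k ih =>
    have ih := ih (by omega)
    intro n
    induction n with
    | zero =>
      refine QR_of f _ _ fun F hF he d => ?_
      rw [const_case f F (fun d hd => ?_) he d]
      · exact zero_mem _
      · exact (Finsupp.degree_eq_zero_iff d).mp (hF d hd).2
    | succ n ihn =>
      refine QR_of f _ _ fun F hF he => ?_
      let a : Fin m := ⟨k, by omega⟩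
      let e : Fin m →₀ ℕ := Finsupp.single a 1
      obtain ⟨H, hHdef⟩ : ∃ H, H = F.divMonomial e := ⟨_, rfl⟩
      obtain ⟨G, hGdef⟩ : ∃ G, G = F.modMonomial e := ⟨_, rfl⟩
      have hFe : X a * H + G = F := by
        rw [hHdef, hGdef]; exact divMonomial_add_modMonomial_single F a
      have hH : Hom (k + 1) n H := by
        intro d hd
        rw [hHdef, coeff_divMonomial] at hd
        obtain ⟨h1, h2⟩ := hF _ hd
        refine ⟨fun i hi => ?_, ?_⟩
        · have := h1 i hi
          rw [Finsupp.add_apply] at this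
          omega
        · rw [map_add, Finsupp.degree_single] at h2
          omega
      have hG : Hom k (n + 1) G := by
        intro d hd
        by_cases hle : e ≤ d
        · rw [hGdef, coeff_modMonomial_of_le _ hle] at hd
          exact absurd rfl hd
        · rw [hGdef, coeff_modMonomial_of_not_le _ hle] at hd
          obtain ⟨h1, h2⟩ := hF _ hd
          refine ⟨fun i hi => ?_, h2⟩
          rcases hi.eq_or_lt with h | h
          · have : i = a := Fin.ext h.symm
            subst this
            rw [Finsupp.single_le_iff] at hle
            omega
          · exact h1 i h
      have hev : f a * eval f H + eval f G = 0 := by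
        rw [← he, ← hFe]; simp
      have hGm : eval f G ∈ J f k ^ (n + 1) := by
        simpa using eval_mem f hG ⊤ (fun _ => trivial)
      have hHm : eval f H ∈ J f k ^ (n + 1) := by
        refine regular_pow f k ih (f a) (hreg a) _ _ ?_
        rw [eq_neg_of_add_eq_zero_left hev]
        exact neg_mem hGm
      have hHc := ihn H hH (Ideal.pow_right_mono (J_mono f (Nat.le_succ k)) _ hHm)
      obtain ⟨H', hH', hee⟩ := exists_hom f k _ _ hHm
      have hGc : ∀ d, coeff d G ∈ J f (k + 1) := by
        intro d
        have h := ih (n + 1) (C (f a) * H' + G) ((hH'.C_mul _).add hG)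
          (by simp [hee, hev]) d
        rw [coeff_add, coeff_C_mul] at h
        have h := J_mono f (Nat.le_succ k) h
        refine (Ideal.add_mem_iff_right _ ?_).mp h
        exact Ideal.mul_mem_right _ _ (Ideal.subset_span ⟨a, Nat.lt_succ_self k, rfl⟩)
      intro d
      rw [← hFe, coeff_add, coeff_X_mul']
      refine add_mem ?_ (hGc d)
      split_ifs
      · exact hHc _
      · exact zero_mem _

lemma cancel_one (f : Fin m → R) (hQ : ∀ n, QR f m n) (i : Fin m) (n : ℕ) (x : R)
    (hx : f i * x ∈ J f m ^ (n + 1)) : x ∈ J f m ^ n := by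
  suffices h : ∀ l, l ≤ n → x ∈ J f m ^ l from h n le_rfl
  intro l
  induction l with
  | zero => simp
  | succ l ih =>
    intro hl
    obtain ⟨F, hF, rfl⟩ := exists_hom f m l x (ih (by omega))
    rw [pow_succ']
    refine eval_mem f hF _ fun d => ?_
    rw [← coeff_X_mul d i F]
    refine hQ (l + 1) _ (hF.X_mul i i.2) ?_ _
    simpa using Ideal.pow_le_pow_right (Nat.succ_le_succ hl) hx

lemma cancel_pow (I : Ideal R) (a : R) (h : ∀ n x, a * x ∈ I ^ (n + 1) → x ∈ I ^ n) (t : ℕ) :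
    ∀ n x, a ^ t * x ∈ I ^ (t + n) → x ∈ I ^ n := by
  induction t with
  | zero => intro n x hx; simpa using hx
  | succ t ih =>
    intro n x hx
    refine h n x (ih (n + 1) _ ?_)
    rw [← mul_assoc, ← pow_succ]
    convert hx using 2
    omega

lemma cancel_prod (I : Ideal R) (f : Fin m → R)
    (h : ∀ i n x, f i * x ∈ I ^ (n + 1) → x ∈ I ^ n) (A : Fin m → ℕ) (S : Finset (Fin m)) :
    ∀ n x, (∏ i ∈ S, f i ^ A i) * x ∈ I ^ (∑ i ∈ S, A i + n) → x ∈ I ^ n := by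
  induction S using Finset.induction_on with
  | empty => intro n x hx; simpa using hx
  | insert i S hi ih =>
    intro n x hx
    rw [Finset.prod_insert hi, Finset.sum_insert hi, mul_assoc, add_assoc] at hx
    exact ih n x (cancel_pow I (f i) (h i) _ _ _ hx)

lemma J_top (f : Fin m → R) : J f m = Ideal.span (Set.range f) := by
  have : {i : Fin m | i.val < m} = Set.univ := by ext i; simp
  rw [J, this, Set.image_univ]

lemma ofList_take (f : Fin m → R) (k : ℕ) : Ideal.ofList ((List.ofFn f).take k) = J f k := by
  rw [Ideal.ofList, J]
  congr 1
  ext x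
  simp only [Set.mem_ofPred_eq, Set.mem_image, List.mem_take_iff_getElem]
  constructor
  · rintro ⟨i, hi, rfl⟩
    simp only [List.length_ofFn, lt_min_iff] at hi
    exact ⟨⟨i, hi.2⟩, hi.1, by simp⟩
  · rintro ⟨i, hi, rfl⟩
    exact ⟨i.val, by simpa using hi, by simp⟩

lemma reg_of (f : Fin m → R) (hreg : RingTheory.Sequence.IsRegular R (List.ofFn f)) (i : Fin m)
    (x : R) (hx : f i * x ∈ J f i.val) : x ∈ J f i.val := by
  have h := hreg.toIsWeaklyRegular.regular_mod_prev i.val (by simp)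
  rw [ofList_take] at h
  have h2 := (isSMulRegular_quotient_iff_mem_of_smul_mem _ _).mp h x
  simp only [List.getElem_ofFn, smul_eq_mul, Ideal.mul_top] at h2
  exact h2 hx

lemma greatest (I : Ideal R) (h : R) (t α : ℕ) (hα : 0 < α) (h1 : h ∈ I ^ t)
    (h2 : h ∉ I ^ (t + 1)) : IsGreatest {n : ℕ | h ∈ I ^ (α * n)} (t / α) := by
  refine ⟨Ideal.pow_le_pow_right (Nat.mul_div_le t α) h1, fun n hn => ?_⟩
  rw [Nat.le_div_iff_mul_le hα]
  by_contra hlt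
  refine h2 (Ideal.pow_le_pow_right ?_ hn)
  rw [mul_comm]
  omega

lemma prod_mem (f : Fin m → R) (A : Fin m → ℕ) :
    ∏ i, f i ^ A i ∈ Ideal.span (Set.range f) ^ (∑ i, A i) := by
  rw [← Finset.prod_pow_eq_pow_sum]
  refine Ideal.prod_mem_prod fun i _ => ?_
  have hi : f i ∈ Ideal.span (Set.range f) := Ideal.subset_span ⟨i, rfl⟩
  exact Ideal.pow_mem_pow hi _

end NAlpha

/-- Local-ring content of Lemma 3.4(ii): with `f₁, …, f_m` a regular sequence
generating `I`, `f^A = f₁^{n₁} ⋯ f_m^{n_m}`, `|A| = n₁ + ⋯ + n_m`, `α` a positive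
integer, and `g` of exact `I`-adic order `s`, the quantity
`n_α(h) := ` the largest `n` with `h ∈ I^{αn}` satisfies `n_α(f^A) = ⌊|A|/α⌋`,
`n_α(g) = ⌊s/α⌋`, `n_α(f^A·g) = ⌊(|A|+s)/α⌋`, and consequently
`-2 < n_α(f^A·g) - n_α(f^A) - n_α(g) < 2`. -/
theorem n_alpha_floor {R : Type*} [CommRing R] {m : ℕ} (f : Fin m → R)
    (hreg : RingTheory.Sequence.IsRegular R (List.ofFn f))
    (A : Fin m → ℕ) (α : ℕ) (hα : 0 < α) (g : R) (s : ℕ)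
    (hgs : g ∈ (Ideal.span (Set.range f)) ^ s)
    (hgs' : g ∉ (Ideal.span (Set.range f)) ^ (s + 1)) :
    IsGreatest {n : ℕ | (∏ i, f i ^ A i) ∈ (Ideal.span (Set.range f)) ^ (α * n)}
      ((∑ i, A i) / α) ∧
    IsGreatest {n : ℕ | g ∈ (Ideal.span (Set.range f)) ^ (α * n)} (s / α) ∧
    IsGreatest {n : ℕ | (∏ i, f i ^ A i) * g ∈ (Ideal.span (Set.range f)) ^ (α * n)}
      (((∑ i, A i) + s) / α) ∧
    (-2 : ℤ) < ((((∑ i, A i) + s) / α : ℕ) : ℤ) - (((∑ i, A i) / α : ℕ) : ℤ)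
        - ((s / α : ℕ) : ℤ) ∧
    ((((∑ i, A i) + s) / α : ℕ) : ℤ) - (((∑ i, A i) / α : ℕ) : ℤ)
        - ((s / α : ℕ) : ℤ) < 2 := by
  have hQ := NAlpha.qr_all f (NAlpha.reg_of f hreg) m le_rfl
  have hc := NAlpha.cancel_one f hQ
  rw [NAlpha.J_top] at hc
  have hcp := NAlpha.cancel_prod _ f hc A Finset.univ
  have hA := NAlpha.prod_mem f A
  refine ⟨NAlpha.greatest _ _ _ _ hα hA fun h => ?_, NAlpha.greatest _ _ _ _ hα hgs hgs',
    NAlpha.greatest _ _ _ _ hα ?_ fun h => hgs' (hcp _ _ h), ?_⟩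
  · have h1 : (1 : R) ∈ Ideal.span (Set.range f) ^ 1 := hcp 1 1 (by simpa using h)
    rw [pow_one] at h1
    refine hgs' ?_
    rw [(Ideal.eq_top_iff_one _).mpr h1, Ideal.top_pow]
    trivial
  · rw [pow_add]
    exact Ideal.mul_mem_mul hA hgs
  · have h1 : (∑ i, A i) / α + s / α ≤ (∑ i, A i + s) / α := Nat.div_add_div_le_add_div
    have h2 : (∑ i, A i + s) / α ≤ (∑ i, A i) / α + s / α + 1 := by
      rw [Nat.add_div hα]
      split_ifs <;> omega
    omega
end

section
/- Define g : ℂ → ℂ by g(z) = exp(z²) − exp(2z) − 1. Then: (i) for every z ∈ ℂ one has exp(z) ≠ 0 and 1 + exp(z)² + g(z) ≠ 0, so that f(z) = [1 : exp(z) : g(z)] defines a holomorphic map from ℂ to ℙ²(ℂ) whose image avoids the three curves D₁ = {x = 0}, D₂ = {y = 0}, and D₃ = {x² + y² + xw = 0} (homogeneous coordinates [x : y : w]); and (ii) f is algebraically nondegenerate, i.e., for every nonzero polynomial P ∈ ℂ[X, Y] there exists z ∈ ℂ such that P(exp(z), g(z)) ≠ 0. -/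
/-- Example 4.2: with `g(z) = exp(z²) − exp(2z) − 1`, the map
`f(z) = [1 : exp z : g z]` lands in `ℙ²(ℂ) ∖ (D₁ ∪ D₂ ∪ D₃)` where
`D₁ = {x = 0}`, `D₂ = {y = 0}`, `D₃ = {x² + y² + xw = 0}` (this amounts to the
nonvanishing of `exp z` and of `1 + (exp z)² + g z`), and `f` is algebraically
nondegenerate: no nonzero two-variable polynomial `P` satisfies
`P(exp z, g z) = 0` for all `z`. -/
theorem entire_curve_nondegenerate (g : ℂ → ℂ)
    (hg : ∀ z : ℂ, g z = Complex.exp (z ^ 2) - Complex.exp (2 * z) - 1) :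
    (∀ z : ℂ, Complex.exp z ≠ 0 ∧ 1 + (Complex.exp z) ^ 2 + g z ≠ 0) ∧
    (∀ P : MvPolynomial (Fin 2) ℂ, P ≠ 0 →
      ∃ z : ℂ, MvPolynomial.eval ![Complex.exp z, g z] P ≠ 0) := by
  refine ⟨fun z => ⟨Complex.exp_ne_zero z, ?_⟩, ?_⟩
  · have h2 : Complex.exp (2 * z) = Complex.exp z ^ 2 := by
      rw [← Complex.exp_nat_mul]; norm_num
    rw [hg, h2]
    ring_nf
    exact Complex.exp_ne_zero _
  · intro P hP
    by_contra! hcon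
    apply hP
    -- for each real `t`, the polynomial `P(exp t, Y)` has infinitely many roots
    have key : ∀ (t : ℝ) (y : ℂ), MvPolynomial.eval ![Complex.exp t, y] P = 0 := by
      intro t
      let Q : Polynomial ℂ :=
        MvPolynomial.aeval ![Polynomial.C (Complex.exp t), Polynomial.X] P
      have hQ : ∀ y, Q.eval y = MvPolynomial.eval ![Complex.exp t, y] P := by
        intro y
        have h := MvPolynomial.comp_aeval_apply
          (![Polynomial.C (Complex.exp t), Polynomial.X] : Fin 2 → Polynomial ℂ)
          (Polynomial.aeval y) P
        rw [Polynomial.coe_aeval_eq_eval] at h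
        change Polynomial.eval y Q = _ at h
        rw [h, MvPolynomial.aeval_eq_eval]
        congr 2
        funext i
        fin_cases i <;> simp
      let zk : ℕ → ℂ := fun k => (t : ℂ) + k * (2 * Real.pi * Complex.I)
      have hper : ∀ k, Complex.exp (zk k) = Complex.exp t := by
        intro k
        simp only [zk]
        rw [Complex.exp_add, Complex.exp_nat_mul_two_pi_mul_I, mul_one]
      have hper2 : ∀ k, Complex.exp (2 * zk k) = Complex.exp t ^ 2 := by
        intro k
        rw [← hper k, ← Complex.exp_nat_mul]; norm_num
      have hinj : Function.Injective (fun k => g (zk k)) := by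
        intro a b hab
        simp only [hg, hper2] at hab
        have h1 : Complex.exp (zk a ^ 2) = Complex.exp (zk b ^ 2) := by
          linear_combination hab
        have h2 := congrArg norm h1
        have hre : ∀ k : ℕ, (zk k ^ 2).re = t ^ 2 - (k * (2 * Real.pi)) ^ 2 := by
          intro k
          simp [zk, pow_two]
        rw [Complex.norm_exp, Complex.norm_exp, Real.exp_eq_exp, hre, hre] at h2
        have h3 : ((a : ℝ) * (2 * Real.pi)) ^ 2 = (b * (2 * Real.pi)) ^ 2 := by linarith
        have h4 := (pow_left_inj₀ (by positivity) (by positivity) two_ne_zero).1 h3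
        exact_mod_cast mul_right_cancel₀ (by positivity) h4
      have hQ0 : Q = 0 := by
        apply Polynomial.eq_zero_of_infinite_isRoot
        refine (Set.infinite_range_of_injective hinj).mono ?_
        rintro _ ⟨k, rfl⟩
        change Q.eval _ = 0
        rw [hQ, ← hper k]
        exact hcon (zk k)
      intro y
      rw [← hQ, hQ0, Polynomial.eval_zero]
    refine MvPolynomial.funext_set
      (![Set.range (fun t : ℝ => Complex.exp t), Set.univ] : Fin 2 → Set ℂ) ?_ ?_
    · intro i
      fin_cases i
      · apply Set.infinite_range_of_injective
        intro a b hab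
        simp only [← Complex.ofReal_exp] at hab
        exact Real.exp_injective (Complex.ofReal_injective hab)
      · exact Set.infinite_univ
    · intro x hx
      obtain ⟨t, ht⟩ := hx 0 (Set.mem_univ _)
      have hx2 : x = ![Complex.exp t, x 1] := by
        funext i
        fin_cases i
        · exact ht.symm
        · rfl
      rw [hx2, key, map_zero]
end

section
/- Let F ∈ ℂ[x, y, u, w] be a homogeneous polynomial. If F(λ·exp(2z), 1, λ·exp(z), exp(z)) = 0 for all λ ∈ ℂ and all z ∈ ℂ, then F(a, b, c, d) = 0 for every (a, b, c, d) ∈ ℂ⁴ with a·b = c·d. -/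
lemma homogeneous_eval_smul_aux (F : MvPolynomial (Fin 4) ℂ) (e : ℕ)
    (hF : F.IsHomogeneous e) (b : ℂ) (v : Fin 4 → ℂ) :
    MvPolynomial.eval (b • v) F = b ^ e * MvPolynomial.eval v F := by
  rw [MvPolynomial.eval_eq', MvPolynomial.eval_eq', Finset.mul_sum]
  refine Finset.sum_congr rfl fun d hd => ?_
  have h := hF (MvPolynomial.mem_support_iff.1 hd)
  have h' : ∑ i, d i = e := by
    rw [← h, Finsupp.weight_apply, Finsupp.sum_fintype _ _ (by simp)]
    simp
  simp only [Pi.smul_apply, smul_eq_mul, mul_pow, Finset.prod_mul_distrib,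
    Finset.prod_pow_eq_pow_sum, h']
  ring

/-- Example 5.1 (density claim): if a homogeneous polynomial
`F ∈ ℂ[x, y, u, w]` vanishes at every point `(λ e^{2z}, 1, λ e^z, e^z)` with
`λ, z ∈ ℂ`, then `F` vanishes on the whole affine cone over the quadric
`xy = uw`. -/
theorem quadric_union_images_dense (F : MvPolynomial (Fin 4) ℂ) (e : ℕ)
    (hF : F.IsHomogeneous e)
    (hvanish : ∀ lam z : ℂ,
      MvPolynomial.eval
        ![lam * Complex.exp (2 * z), 1, lam * Complex.exp z, Complex.exp z] F = 0) :
    ∀ a b c d : ℂ, a * b = c * d → MvPolynomial.eval ![a, b, c, d] F = 0 := by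
  -- vanishing on the open part
  have key : ∀ a b c d : ℂ, a * b = c * d → b ≠ 0 → d ≠ 0 →
      MvPolynomial.eval ![a, b, c, d] F = 0 := by
    intro a b c d h hb hd
    have h1 := hvanish (c / d) (Complex.log (d / b))
    have h2 : Complex.exp (Complex.log (d / b)) = d / b :=
      Complex.exp_log (div_ne_zero hd hb)
    rw [two_mul, Complex.exp_add, h2] at h1
    have h3 : (![a, b, c, d] : Fin 4 → ℂ) =
        b • ![c / d * (d / b * (d / b)), 1, c / d * (d / b), d / b] := by
      ext i
      fin_cases i <;> simp <;> field_simp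
      linear_combination h
    rw [h3, homogeneous_eval_smul_aux F e hF, h1]
    simp
  -- vanishing on the image of the Segre parametrization, by continuity
  have par : ∀ p q r s : ℂ, MvPolynomial.eval ![p * r, q * s, p * s, q * r] F = 0 := by
    intro p q r s
    have hc : Continuous fun t : ℂ => MvPolynomial.eval
        ![p * (r + t), (q + t) * (s + t), p * (s + t), (q + t) * (r + t)] F := by
      refine (MvPolynomial.continuous_eval F).comp ?_
      refine continuous_pi fun i => ?_
      fin_cases i <;> simp <;> fun_prop
    have hd : Dense (({-q, -r, -s} : Set ℂ)ᶜ) :=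
      Set.Countable.dense_compl ℝ (Set.toFinite _).countable
    have h0 := Continuous.ext_on hd hc (continuous_const (y := (0 : ℂ))) (by
      intro t ht
      simp only [Set.mem_compl_iff, Set.mem_insert_iff, Set.mem_singleton_iff, not_or] at ht
      obtain ⟨hq, hr, hs⟩ := ht
      have hq : q + t ≠ 0 := fun h => hq (by linear_combination h)
      have hr : r + t ≠ 0 := fun h => hr (by linear_combination h)
      have hs : s + t ≠ 0 := fun h => hs (by linear_combination h)
      exact key _ _ _ _ (by ring) (mul_ne_zero hq hs) (mul_ne_zero hq hr))
    simpa using congrFun h0 0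
  intro a b c d h
  by_cases ha : a = 0
  · subst ha
    rcases mul_eq_zero.1 (h.symm.trans (zero_mul b)) with hc | hd
    · subst hc
      simpa using par 0 1 d b
    · subst hd
      simpa using par c b 0 1
  · have h1 := par a d 1 (c / a)
    have h2 : d * (c / a) = b := by
      field_simp
      linear_combination -h
    rw [h2, mul_div_cancel₀ _ ha] at h1
    simpa using h1
end
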